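/- If G is a finite group with integer-valued character table, then for every N, the wreath product G ≀ S_N also has an integer-valued character table. -/

import Mathlib

open CategoryTheory

/-- The wreath product `G ≀ S_N`, as the semidirect product `G^N ⋊ S_N` where `S_N`
permutes the coordinates (equivalently, `N×N` permutation matrices with entries in `G`). -/
abbrev WreathProduct (G : Type) [Group G] (N : ℕ) : Type :=
  (Fin N → G) ⋊[mulAutArrow] Equiv.Perm (Fin N)

section

open Polynomial
open scoped MonoidAlgebra

theorem Module.End.exists_intPolynomial_trace_pow {V : Type*} [AddCommGroup V] [Module ℂ V]
    [FiniteDimensional ℂ V] {n : ℕ} (hn : 0 < n) {ζ : ℂ} (hζ : IsPrimitiveRoot ζ n)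
    {f : Module.End ℂ V} (hf : f ^ n = 1) :
    ∃ P : ℤ[X], ∀ k : ℕ, LinearMap.trace ℂ V (f ^ k) = aeval (ζ ^ k) P := by
  have hn' : (n : ℂ) ≠ 0 := by exact_mod_cast hn.ne'
  have hζ0 : ζ ≠ 0 := hζ.ne_zero hn.ne'
  let e : ℕ → Module.End ℂ V := fun a =>
    (n : ℂ)⁻¹ • ∑ k ∈ Finset.range n, ((ζ⁻¹) ^ a • f) ^ k
  have hfe (a : ℕ) : f * e a = ζ ^ a • e a := by
    have h1 : ((ζ⁻¹) ^ a • f) ^ n = 1 := by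
      rw [_root_.smul_pow, hf, ← pow_mul, mul_comm, pow_mul, inv_pow, hζ.pow_eq_one]
      simp
    have h2 := mul_geom_sum ((ζ⁻¹) ^ a • f) n
    rw [h1, sub_self, sub_mul, one_mul, sub_eq_zero] at h2
    have h3 : ((ζ⁻¹) ^ a • f) * e a = e a := by
      simp only [e, mul_smul_comm, h2]
    rw [smul_mul_assoc] at h3
    rw [← h3, smul_smul, h3, inv_pow, mul_inv_cancel₀ (pow_ne_zero _ hζ0), one_smul]
  have hfke (a k : ℕ) : f ^ k * e a = (ζ ^ k) ^ a • e a := by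
    induction k with
    | zero => simp
    | succ k ih =>
      rw [pow_succ, mul_assoc, hfe, mul_smul_comm, ih, smul_smul, pow_succ, mul_pow, mul_comm]
  have hidem (a : ℕ) : IsIdempotentElem (e a) := by
    have : ∀ k, ((ζ⁻¹) ^ a • f) ^ k * e a = e a := fun k => by
      rw [_root_.smul_pow, smul_mul_assoc, hfke, smul_smul, ← pow_mul, ← pow_mul, mul_comm k a,
        ← mul_pow, inv_mul_cancel₀ hζ0, one_pow, one_smul]
    rw [IsIdempotentElem]
    nth_rewrite 1 [show e a = (n : ℂ)⁻¹ • ∑ k ∈ Finset.range n, ((ζ⁻¹) ^ a • f) ^ k from rfl]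
    rw [smul_mul_assoc, Finset.sum_mul, Finset.sum_congr rfl fun k _ => this k]
    simp [← Nat.cast_smul_eq_nsmul ℂ, smul_smul, hn']
  have hsum : ∑ a ∈ Finset.range n, e a = 1 := by
    have key : ∀ k ∈ Finset.range n,
        ∑ a ∈ Finset.range n, ((ζ⁻¹) ^ a • f) ^ k = if k = 0 then (n : ℂ) • 1 else 0 := by
      intro k hk
      have : ∀ a, ((ζ⁻¹) ^ a • f) ^ k = (ζ⁻¹ ^ k) ^ a • f ^ k := fun a => by
        rw [_root_.smul_pow, ← pow_mul, ← pow_mul, mul_comm]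
      simp only [this, ← Finset.sum_smul]
      split_ifs with h
      · simp [h]
      · have h1 : ζ⁻¹ ^ k ≠ 1 :=
          hζ.inv.pow_ne_one_of_pos_of_lt h (Finset.mem_range.1 hk)
        rw [geom_sum_eq h1, ← pow_mul, mul_comm, pow_mul, hζ.inv.pow_eq_one]
        simp
    simp only [e]
    rw [← Finset.smul_sum, Finset.sum_comm, Finset.sum_congr rfl key, Finset.sum_ite_eq']
    simp [hn, smul_smul, hn']
  refine ⟨∑ a ∈ Finset.range n, C (Module.finrank ℂ (LinearMap.range (e a)) : ℤ) * X ^ a,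
    fun k => ?_⟩
  rw [← mul_one (f ^ k), ← hsum, Finset.mul_sum, map_sum, map_sum]
  refine Finset.sum_congr rfl fun a _ => ?_
  rw [hfke, map_smul, ((LinearMap.isProj_range_iff_isIdempotentElem _).2 (hidem a)).trace]
  simp [mul_comm]

theorem IsPrimitiveRoot.aeval_pow_eq_of_aeval_eq_intCast {n : ℕ} (hn : 0 < n) {ζ : ℂ}
    (hζ : IsPrimitiveRoot ζ n) {P : ℤ[X]} {m : ℤ} (h : aeval ζ P = m) {j : ℕ}
    (hj : j.Coprime n) : aeval (ζ ^ j) P = m := by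
  have hd : cyclotomic n ℤ ∣ P - C m := by
    rw [cyclotomic_eq_minpoly hζ hn]
    exact minpoly.isIntegrallyClosed_dvd (hζ.isIntegral hn) (by simp [h])
  obtain ⟨Q, hQ⟩ := hd
  have hroot : aeval (ζ ^ j) (cyclotomic n ℤ) = 0 := by
    rw [cyclotomic_eq_minpoly (hζ.pow_of_coprime j hj) hn]
    exact minpoly.aeval _ _
  have := congrArg (aeval (ζ ^ j)) hQ
  rw [map_mul, hroot, zero_mul, map_sub, sub_eq_zero] at this
  simpa using this

theorem IsPrimitiveRoot.exists_intCast_of_aeval_pow_eq {n : ℕ} (hn : 0 < n) {ζ : ℂ}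
    (hζ : IsPrimitiveRoot ζ n) {P : ℤ[X]}
    (h : ∀ j : ℕ, j.Coprime n → aeval (ζ ^ j) P = aeval ζ P) : ∃ m : ℤ, aeval ζ P = m := by
  set R := P %ₘ cyclotomic n ℤ with hR
  have hmon := cyclotomic.monic n ℤ
  have heval (ξ : ℂ) (hξ : IsPrimitiveRoot ξ n) : aeval ξ R = aeval ξ P := by
    conv_rhs => rw [← modByMonic_add_div P (cyclotomic n ℤ)]
    have : aeval ξ (cyclotomic n ℤ) = 0 := by
      rw [cyclotomic_eq_minpoly hξ hn]
      exact minpoly.aeval _ _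
    simp [this, hR]
  have hdeg : R.degree < n.totient := by
    rw [← degree_cyclotomic n ℤ]
    exact degree_modByMonic_lt _ hmon
  have hzero : R.map (algebraMap ℤ ℂ) - C (aeval ζ P) = 0 := by
    refine eq_zero_of_degree_lt_of_eval_finset_eq_zero (primitiveRoots n ℂ) ?_ ?_
    · rw [hζ.card_primitiveRoots]
      refine (degree_sub_le _ _).trans_lt (max_lt ((degree_map_le).trans_lt hdeg) ?_)
      exact degree_C_le.trans_lt (by exact_mod_cast Nat.totient_pos.2 hn)
    · intro ξ hξ
      rw [mem_primitiveRoots hn] at hξ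
      have : NeZero n := ⟨hn.ne'⟩
      obtain ⟨j, -, hj, rfl⟩ := hζ.isPrimitiveRoot_iff.1 hξ
      rw [eval_sub, eval_C, eval_map_algebraMap, heval _ hξ, h j hj, sub_self]
  refine ⟨R.coeff 0, ?_⟩
  have := congrArg (coeff · 0) hzero
  simp [sub_eq_zero] at this
  exact this.symm

theorem FDRep.simple_of_isIrreducible {k G V : Type} [Field k] [IsAlgClosed k] [Group G] [Finite G]
    [NeZero (Nat.card G : k)] [AddCommGroup V] [Module k V] [FiniteDimensional k V]
    (ρ : Representation k G V) [ρ.IsIrreducible] : Simple (FDRep.of ρ) := by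
  rw [FDRep.simple_iff_end_is_rank_one,
    ← (FDRep.forget₂HomLinearEquiv (FDRep.of ρ) (FDRep.of ρ)).finrank_eq,
    (Rep.homLinearEquiv _ _).finrank_eq]
  exact Representation.IsIrreducible.finrank_intertwiningMap_self ρ

theorem Representation.IsIrreducible.asAlgebraHom_eq_zero_of_trace_eq_zero {k G V : Type*} [Field k]
    [CharZero k] [IsAlgClosed k] [Group G] [AddCommGroup V] [Module k V] [FiniteDimensional k V]
    (ρ : Representation k G V) [ρ.IsIrreducible] {z : k[G]} (hz : z ∈ Submonoid.center k[G])
    (htr : LinearMap.trace k V (ρ.asAlgebraHom z) = 0) : ρ.asAlgebraHom z = 0 := by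
  obtain ⟨c, hc⟩ := (algebraMap_intertwiningMap_bijective_of_isAlgClosed (ρ := ρ)).2
    (IntertwiningMap.centralAlgebraMul ρ hz)
  have hc' : ρ.asAlgebraHom z = c • LinearMap.id := by
    ext v
    exact (congrArg (fun T : ρ.IntertwiningMap ρ => T v) hc).symm
  rw [hc', map_smul, LinearMap.trace_id, smul_eq_mul, mul_eq_zero, Nat.cast_eq_zero,
    Module.finrank_eq_zero_iff_of_free] at htr
  rcases htr with rfl | h
  · rw [hc', zero_smul]
  · ext v
    exact Subsingleton.elim _ _

theorem Representation.asAlgebraHom_ofModule'_apply {k G : Type*} [Field k] [Monoid G] {M : Type*}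
    [AddCommGroup M] [Module k M] [Module k[G] M] [IsScalarTower k k[G] M] (z : k[G]) (v : M) :
    (ofModule' M : Representation k G M).asAlgebraHom z v = z • v := by
  exact DFunLike.congr_fun (DFunLike.congr_fun
    ((MonoidAlgebra.lift k (Module.End k M) G).apply_symm_apply (Algebra.lsmul k k M)) z) v

theorem Representation.isIrreducible_ofModule' {k G : Type*} [Field k] [Monoid G] (M : Type*)
    [AddCommGroup M] [Module k M] [Module k[G] M] [IsScalarTower k k[G] M] [IsSimpleModule k[G] M] :
    (ofModule' M : Representation k G M).IsIrreducible := by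
  rw [irreducible_iff_isSimpleModule_asModule]
  let ρ : Representation k G M := ofModule' M
  let e : ρ.asModule ≃ₗ[k[G]] M :=
    { ρ.asModuleEquiv with
      map_smul' := fun z v =>
        (ρ.asModuleEquiv_map_smul z v).trans (asAlgebraHom_ofModule'_apply z _) }
  exact IsSimpleModule.congr e

theorem isConj_of_character_eq {G : Type} [Group G] [Finite G] {g h : G}
    (hgh : ∀ V : FDRep ℂ G, Simple V → V.character g = V.character h) : IsConj g h := by
  classical
  have := Fintype.ofFinite G
  let z : G → ℂ[G] := fun g => ∑ x : G, MonoidAlgebra.single (x * g * x⁻¹) 1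
  have hcomm (g y : G) : MonoidAlgebra.single y 1 * z g = z g * MonoidAlgebra.single y 1 := by
    simp only [z, Finset.mul_sum, Finset.sum_mul, MonoidAlgebra.single_mul_single, one_mul]
    refine Fintype.sum_equiv (Equiv.mulLeft y) _ _ fun x => ?_
    simp [mul_assoc]
  have hcenter : z g - z h ∈ Submonoid.center ℂ[G] := by
    rw [Submonoid.mem_center_iff]
    intro a
    induction a using MonoidAlgebra.induction_on with
    | of y => simp [mul_sub, sub_mul, hcomm]
    | add a b ha hb => rw [add_mul, mul_add, ha, hb]
    | smul r a ha => rw [smul_mul_assoc, mul_smul_comm, ha]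
  have hsimple (M : Type) [AddCommGroup M] [Module ℂ M] [Module ℂ[G] M] [IsScalarTower ℂ ℂ[G] M]
      [IsSimpleModule ℂ[G] M] (v : M) : (z g - z h) • v = 0 := by
    let ρ : Representation ℂ G M := Representation.ofModule' M
    have : ρ.IsIrreducible := Representation.isIrreducible_ofModule' M
    have : Module.Finite ℂ ℂ[G] := Module.Finite.equiv (MonoidAlgebra.coeffLinearEquiv ℂ).symm
    have : Module.Finite ℂ M := .trans ℂ[G] M
    have htr (g : G) : LinearMap.trace ℂ _ (ρ.asAlgebraHom (z g)) =
        Fintype.card G * (FDRep.of ρ).character g := by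
      have h1 (x : G) : LinearMap.trace ℂ _ (ρ (x * g * x⁻¹)) = (FDRep.of ρ).character g :=
        (FDRep.of ρ).char_conj g x
      simp only [z, map_sum, Representation.asAlgebraHom_single_one, h1]
      simp
    have h0 := Representation.IsIrreducible.asAlgebraHom_eq_zero_of_trace_eq_zero ρ hcenter (by
      rw [map_sub, map_sub, htr, htr, hgh _ (FDRep.simple_of_isIrreducible ρ), sub_self])
    rw [← Representation.asAlgebraHom_ofModule'_apply, h0, LinearMap.zero_apply]
  have hz : z g - z h = 0 := by
    have hmem : z g - z h ∈ Ring.jacobson ℂ[G] := by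
      rw [Ring.jacobson_eq_sInf_isMaximal, Ideal.mem_sInf]
      intro m hm
      have : IsSimpleModule ℂ[G] (ℂ[G] ⧸ m) := isSimpleModule_iff_isCoatom.2 hm.out.out
      have := hsimple (ℂ[G] ⧸ m) (Submodule.Quotient.mk 1)
      rwa [← Submodule.Quotient.mk_smul, Submodule.Quotient.mk_eq_zero, smul_eq_mul, mul_one]
        at this
    rwa [IsSemisimpleRing.jacobson_eq_bot] at hmem
  have hcoeff (u v : G) : (z u).coeff v ≠ 0 ↔ IsConj u v := by
    simp [z, MonoidAlgebra.coeff_sum, Finsupp.finsetSum_apply, Finsupp.single_apply,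
      Finset.filter_eq_empty_iff, isConj_iff]
  rw [isConj_comm, ← hcoeff, ← sub_eq_zero.1 hz, hcoeff]

theorem FDRep.exists_intPolynomial_character_pow {G : Type} [Group G] [Finite G]
    (V : FDRep ℂ G) (g : G) {ζ : ℂ} (hζ : IsPrimitiveRoot ζ (Nat.card G)) :
    ∃ P : ℤ[X], ∀ k : ℕ, V.character (g ^ k) = aeval (ζ ^ k) P := by
  obtain ⟨P, hP⟩ := Module.End.exists_intPolynomial_trace_pow Nat.card_pos hζ
    (f := V.ρ g) (by rw [← map_pow, pow_card_eq_one', map_one])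
  exact ⟨P, fun k => by rw [← hP, FDRep.character, map_pow]⟩

theorem isConj_pow_of_integer_characters {G : Type} [Group G] [Finite G]
    (hint : ∀ V : FDRep ℂ G, Simple V → ∀ g : G, ∃ n : ℤ, V.character g = n) (g : G) {j : ℕ}
    (hj : j.Coprime (Nat.card G)) : IsConj g (g ^ j) := by
  refine isConj_of_character_eq fun V hV => ?_
  have hζ := Complex.isPrimitiveRoot_exp (Nat.card G) Nat.card_pos.ne'
  obtain ⟨P, hP⟩ := V.exists_intPolynomial_character_pow g hζ
  obtain ⟨m, hm⟩ := hint V hV g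
  rw [hm, hP, hζ.aeval_pow_eq_of_aeval_eq_intCast Nat.card_pos _ hj]
  rw [← hm, ← pow_one g, hP, pow_one]

theorem exists_character_eq_intCast_of_isConj_pow {G : Type} [Group G] [Finite G]
    (V : FDRep ℂ G) (g : G) (hg : ∀ j : ℕ, j.Coprime (Nat.card G) → IsConj g (g ^ j)) :
    ∃ n : ℤ, V.character g = n := by
  have hζ := Complex.isPrimitiveRoot_exp (Nat.card G) Nat.card_pos.ne'
  obtain ⟨P, hP⟩ := V.exists_intPolynomial_character_pow g hζ
  have hP1 := hP 1
  rw [pow_one, pow_one] at hP1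
  rw [hP1]
  refine hζ.exists_intCast_of_aeval_pow_eq Nat.card_pos fun j hj => ?_
  obtain ⟨c, hc⟩ := isConj_iff.1 (hg j hj)
  rw [← hP, ← hP1, ← hc, V.char_conj]

end

namespace WreathProduct

variable {G : Type} [Group G] {N : ℕ}

/-- The entry of `w` in column `i`. -/
def entry (w : WreathProduct G N) (i : Fin N) : G := w.left (w.right i)

theorem entry_mul (w v : WreathProduct G N) (i : Fin N) :
    entry (w * v) i = entry w (v.right i) * entry v i := by
  have h : mulAutArrow w.right v.left (w.right (v.right i)) = v.left (v.right i) :=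
    congrArg v.left (w.right.symm_apply_apply _)
  exact congrArg (w.left (w.right (v.right i)) * ·) h

theorem ext_entry {w v : WreathProduct G N} (hr : w.right = v.right)
    (h : ∀ i, entry w i = entry v i) : w = v := by
  refine SemidirectProduct.ext (funext fun i => ?_) hr
  have := h (w.right.symm i)
  simpa [entry, ← hr] using this

theorem entry_zpow_of_right_eq {w : WreathProduct G N} {i : Fin N} (h : w.right i = i) (k : ℤ) :
    (w ^ k).right i = i ∧ entry (w ^ k) i = entry w i ^ k := by
  let S : Subgroup (WreathProduct G N) :=
    (MulAction.stabilizer (Equiv.Perm (Fin N)) i).comap SemidirectProduct.rightHom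
  let φ : S →* G :=
    MonoidHom.mk' (fun w => entry (w : WreathProduct G N) i) fun a b => by
      rw [Subgroup.coe_mul, entry_mul, show (b : WreathProduct G N).right i = i from b.2]
  exact ⟨((⟨w, h⟩ : S) ^ k).2, map_zpow φ ⟨w, h⟩ k⟩

theorem right_zpow (w : WreathProduct G N) (k : ℤ) : (w ^ k).right = w.right ^ k :=
  map_zpow SemidirectProduct.rightHom w k

theorem right_pow (w : WreathProduct G N) (k : ℕ) : (w ^ k).right = w.right ^ k :=
  map_pow SemidirectProduct.rightHom w k

theorem exists_entry_zpow_semiconj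
    (hG : ∀ (g : G) (j : ℕ), j.Coprime (Nat.card G) → IsConj g (g ^ j))
    (x : WreathProduct G N) {j : ℕ} (hj : j.Coprime (Nat.card G)) (i : Fin N) :
    ∃ d : G, ∀ m : ℤ, (x ^ m).right i = i →
      d * entry (x ^ m) i = entry ((x ^ j) ^ m) i * d := by
  set l := Function.minimalPeriod (x.right • · : Fin N → Fin N) i with hl
  have hxl : (x ^ (l : ℤ)).right i = i := by
    rw [right_zpow]
    exact (MulAction.zpow_smul_eq_iff_minimalPeriod_dvd (a := x.right)).2 dvd_rfl
  obtain ⟨d, hd⟩ := isConj_iff.1 (hG (entry (x ^ (l : ℤ)) i) j hj)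
  refine ⟨d, fun m hm => ?_⟩
  obtain ⟨t, rfl⟩ : (l : ℤ) ∣ m := by
    rw [right_zpow] at hm
    exact (MulAction.zpow_smul_eq_iff_minimalPeriod_dvd (a := x.right)).1 hm
  have hsemi : SemiconjBy d (entry (x ^ (l : ℤ)) i) (entry (x ^ (l : ℤ)) i ^ j) :=
    mul_inv_eq_iff_eq_mul.1 hd
  have hy : (x ^ j) ^ ((l : ℤ) * t) = (x ^ ((l : ℤ) * t)) ^ (j : ℤ) := by
    rw [← zpow_natCast, ← zpow_mul, ← zpow_mul, mul_comm]
  rw [hy, (entry_zpow_of_right_eq hm j).2, zpow_mul, (entry_zpow_of_right_eq hxl t).2,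
    zpow_comm _ t, zpow_natCast (entry _ i) j]
  exact (hsemi.zpow_right t).eq

theorem isConj_pow (hG : ∀ (g : G) (j : ℕ), j.Coprime (Nat.card G) → IsConj g (g ^ j))
    (x : WreathProduct G N) {j : ℕ} (hjG : j.Coprime (Nat.card G))
    (hjN : j.Coprime (orderOf x.right)) : IsConj x (x ^ j) := by
  choose d hd using exists_entry_zpow_semiconj hG x hjG
  set y := x ^ j with hy
  -- `x` and `y` have the same stabilizers in `ℤ` on columns.
  have hfix (m : ℤ) (i : Fin N) : (y ^ m).right i = i ↔ (x ^ m).right i = i := by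
    have hym : (y ^ m).right = (x ^ m).right ^ j := by
      rw [← right_pow, hy, ← zpow_natCast, ← zpow_natCast, ← zpow_mul, ← zpow_mul, mul_comm]
    have hpow {σ : Equiv.Perm (Fin N)} (k : ℕ) (h : σ i = i) : (σ ^ k) i = i :=
      Function.IsFixedPt.perm_pow h k
    refine ⟨fun h => ?_, fun h => hym ▸ hpow j h⟩
    obtain ⟨k, hk⟩ := exists_pow_eq_self_of_coprime (x := (x ^ m).right) (n := j)
      (hjN.coprime_dvd_right (right_zpow x m ▸ orderOf_dvd_of_mem_zpowers ⟨m, rfl⟩))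
    rw [← hk, ← hym]
    exact hpow k h
  let T (m : ℤ) (i : Fin N) : G := entry (y ^ m) i * d i * (entry (x ^ m) i)⁻¹
  have hT {a b : ℤ} {i : Fin N} (h : (x ^ a).right i = (x ^ b).right i) :
      T a i = T b i ∧ (y ^ a).right i = (y ^ b).right i := by
    obtain ⟨c, rfl⟩ : ∃ c, a = b + c := ⟨a - b, by ring⟩
    have hc : (x ^ c).right i = i := by
      rw [zpow_add, SemidirectProduct.mul_right, Equiv.Perm.mul_apply] at h
      exact (x ^ b).right.injective h
    have hc' := (hfix c i).2 hc
    constructor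
    · simp only [T, zpow_add, entry_mul, hc, hc', mul_inv_rev]
      rw [mul_assoc (entry (y ^ b) i), ← hd i c hc]
      group
    · rw [zpow_add, SemidirectProduct.mul_right, Equiv.Perm.mul_apply, hc']
  let s := Equiv.Perm.SameCycle.setoid x.right
  let r (i : Fin N) : Fin N := (Quotient.mk s i).out
  have hr (i : Fin N) : ∃ k : ℤ, (x ^ k).right (r i) = i := by
    obtain ⟨k, hk⟩ : x.right.SameCycle (r i) i := Quotient.exact (s := s) (Quotient.out_eq _)
    exact ⟨k, by rw [right_zpow, hk]⟩
  choose k hk using hr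
  have hr_right (i : Fin N) : r (x.right i) = r i :=
    congrArg Quotient.out (Quotient.sound (s := s) (Equiv.Perm.sameCycle_apply_left.2 (.refl _ _)))
  let τ (i : Fin N) : Fin N := (y ^ k i).right (r i)
  have hr_τ (i : Fin N) : r (τ i) = r i := by
    refine (congrArg Quotient.out (Quotient.sound (s := s) ?_)).trans
      (congrArg Quotient.out (Quotient.out_eq (Quotient.mk s i)))
    refine Equiv.Perm.SameCycle.symm ⟨j * k i, ?_⟩
    simp only [τ, hy]
    rw [right_zpow, right_pow, zpow_mul, zpow_natCast]
  have hτ_inj : Function.Injective τ := fun a b hab => by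
    have hrab : r a = r b := by rw [← hr_τ, hab, hr_τ]
    rw [← hk a, ← hk b, ← hrab]
    simp only [τ, ← hrab] at hab
    obtain ⟨c, hc⟩ : ∃ c, k a = k b + c := ⟨k a - k b, by ring⟩
    rw [hc, zpow_add, SemidirectProduct.mul_right, Equiv.Perm.mul_apply] at hab ⊢
    rw [(hfix c _).1 ((y ^ k b).right.injective hab)]
  let σ : Equiv.Perm (Fin N) := .ofBijective τ (Finite.injective_iff_bijective.1 hτ_inj)
  let c : WreathProduct G N := ⟨fun i => T (k (σ.symm i)) (r (σ.symm i)), σ⟩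
  have hc_entry (i : Fin N) : entry c i = T (k i) (r i) := by simp [entry, c]
  have hstep (i : Fin N) : T (k (x.right i)) (r i) = T (1 + k i) (r i) ∧
      (y ^ k (x.right i)).right (r i) = (y ^ (1 + k i)).right (r i) := by
    refine hT ?_
    conv_lhs => rw [← hr_right, hk]
    rw [zpow_add, zpow_one, SemidirectProduct.mul_right, Equiv.Perm.mul_apply, hk]
  refine isConj_iff.2 ⟨c, mul_inv_eq_iff_eq_mul.2 (ext_entry ?_ fun i => ?_)⟩
  · ext1 i
    change τ (x.right i) = y.right (τ i)
    simp only [τ, hr_right]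
    rw [(hstep i).2, zpow_add, zpow_one, SemidirectProduct.mul_right, Equiv.Perm.mul_apply]
  · rw [entry_mul, entry_mul, hc_entry, hc_entry, hr_right, (hstep i).1]
    simp only [T, zpow_add, zpow_one, entry_mul, hk, mul_inv_rev]
    rw [show c.right i = (y ^ k i).right (r i) from rfl]
    group

end WreathProduct

/-- If `G` is a finite group with integer-valued character table, then for
every `N` the wreath product `G ≀ S_N` also has an integer-valued character table. -/
theorem wreathProduct_integer_character_table (G : Type) [Group G] [Finite G]
    (hint : ∀ V : FDRep ℂ G, Simple V → ∀ g : G, ∃ n : ℤ, V.character g = n) (N : ℕ) :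
    ∀ W : FDRep ℂ (WreathProduct G N), Simple W →
      ∀ x : WreathProduct G N, ∃ n : ℤ, W.character x = n := by
  have : Finite (WreathProduct G N) := Finite.of_equiv _ SemidirectProduct.equivProd.symm
  have hcard : Nat.card (WreathProduct G N) = Nat.card G ^ N * Nat.card (Equiv.Perm (Fin N)) := by
    rw [SemidirectProduct.card, Nat.card_fun, Nat.card_fin]
  intro W _ x
  refine exists_character_eq_intCast_of_isConj_pow W x fun j hj => ?_
  have hjN : j.Coprime (orderOf x.right) := hj.coprime_dvd_right
    ((orderOf_map_dvd SemidirectProduct.rightHom x).trans (orderOf_dvd_natCard x))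
  rcases N.eq_zero_or_pos with rfl | hN
  · have : x ^ j = x := SemidirectProduct.ext (Subsingleton.elim _ _) (Subsingleton.elim _ _)
    rw [this]
  · refine WreathProduct.isConj_pow (fun g j hj => isConj_pow_of_integer_characters hint g hj) x
      (hj.coprime_dvd_right ?_) hjN
    exact hcard ▸ (dvd_pow_self _ hN.ne').mul_right _
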